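/- arXiv:2107.01266 — 8 statements merged into one kernel-verified Lean document; each statement's English description precedes it below -/
import Mathlib

section
/- For every s ∈ ℝ^p, γ ∈ [0,1] and λ ≥ 0, the vector η_γ(s, λ) is the unique global minimizer over β ∈ ℝ^p of the SGL proximal cost C(s, β). -/
noncomputable section

/-- Soft-thresholding operator. -/
def softThresh (x b : ℝ) : ℝ :=
  if x > b then x - b else if x < -b then x + b else 0

/-- ℓ₂ norm of the subvector of `v` on the group of index `j`. -/
def groupNorm {p L : ℕ} (g : Fin p → Fin L) (v : Fin p → ℝ) (j : Fin p) : ℝ :=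
  Real.sqrt (∑ i : Fin p, if g i = g j then (v i) ^ 2 else 0)

/-- Size of the group of index `j`. -/
def groupSize {p L : ℕ} (g : Fin p → Fin L) (j : Fin p) : ℕ :=
  (Finset.univ.filter fun i => g i = g j).card

/-- SGL proximal operator, componentwise. -/
def sglProx {p L : ℕ} (g : Fin p → Fin L) (γ lam : ℝ) (s : Fin p → ℝ) (j : Fin p) : ℝ :=
  if groupNorm g (fun i => softThresh (s i) (γ * lam)) j
      > (1 - γ) * lam * Real.sqrt (groupSize g j) then
    softThresh (s j) (γ * lam) *
      (1 - (1 - γ) * lam * Real.sqrt (groupSize g j) /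
        groupNorm g (fun i => softThresh (s i) (γ * lam)) j)
  else 0

/-- Size of group `l`. -/
def sizeOfGroup {p L : ℕ} (g : Fin p → Fin L) (l : Fin L) : ℕ :=
  (Finset.univ.filter fun i => g i = l).card

/-- SGL proximal cost
  `C(s, β) = ½‖s − β‖₂² + (1−γ)λ Σ_l √(p_l) ‖β_l‖₂ + γλ‖β‖₁`. -/
def sglProxCost {p L : ℕ} (g : Fin p → Fin L) (γ lam : ℝ) (s β : Fin p → ℝ) : ℝ :=
  (1 / 2) * ∑ i : Fin p, (s i - β i) ^ 2
    + (1 - γ) * lam * ∑ l : Fin L, Real.sqrt (sizeOfGroup g l) *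
        Real.sqrt (∑ i : Fin p, if g i = l then (β i) ^ 2 else 0)
    + γ * lam * ∑ i : Fin p, |β i|

theorem softThresh_residual_mul_le {b : ℝ} (hb : 0 ≤ b) {c : ℝ} (hc : 0 ≤ c) (x y : ℝ) :
    (x - softThresh x b) * (y - c * softThresh x b) ≤ b * (|y| - |c * softThresh x b|) := by
  rw [abs_mul, abs_of_nonneg hc]
  unfold softThresh
  split_ifs with h₁ h₂
  · rw [abs_of_pos (show 0 < x - b by linarith)]
    nlinarith [mul_le_mul_of_nonneg_left (le_abs_self y) hb]
  · rw [abs_of_neg (show x + b < 0 by linarith)]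
    nlinarith [mul_le_mul_of_nonneg_left (neg_le_abs y) hb]
  · have hx : |x| ≤ b := abs_le.2 ⟨by linarith, by linarith⟩
    have hxy : x * y ≤ |x| * |y| := (le_abs_self _).trans (abs_mul x y).le
    simpa using hxy.trans (mul_le_mul_of_nonneg_right hx (abs_nonneg y))

/-- The factor by which the block soft-thresholding at level `a` scales a vector of norm `N`. -/
def blockShrinkage (N a : ℝ) : ℝ := if N > a then 1 - a / N else 0

theorem blockShrinkage_nonneg {N a : ℝ} (ha : 0 ≤ a) : 0 ≤ blockShrinkage N a := by
  unfold blockShrinkage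
  split_ifs with h
  · exact sub_nonneg.2 ((div_le_one (ha.trans_lt h)).2 h.le)
  · exact le_rfl

theorem blockShrinkage_residual_le {ι : Type*} (G : Finset ι) (t β : ι → ℝ) {a c : ℝ}
    (ha : 0 ≤ a) (hc : c = blockShrinkage √(∑ i ∈ G, t i ^ 2) a) :
    (1 - c) * ∑ i ∈ G, t i * (β i - c * t i)
      ≤ a * (√(∑ i ∈ G, β i ^ 2) - √(∑ i ∈ G, (c * t i) ^ 2)) := by
  have hc0 : 0 ≤ c := hc ▸ blockShrinkage_nonneg ha
  have cauchy := Real.sum_mul_le_sqrt_mul_sqrt G t β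
  have hnorm : √(∑ i ∈ G, (c * t i) ^ 2) = c * √(∑ i ∈ G, t i ^ 2) := by
    simp only [mul_pow, ← Finset.mul_sum]
    rw [Real.sqrt_mul (sq_nonneg c), Real.sqrt_sq hc0]
  have hinner : ∑ i ∈ G, t i * (β i - c * t i)
      = ∑ i ∈ G, t i * β i - c * √(∑ i ∈ G, t i ^ 2) ^ 2 := by
    rw [Real.sq_sqrt (Finset.sum_nonneg fun i _ => sq_nonneg (t i)), Finset.mul_sum,
      ← Finset.sum_sub_distrib]
    exact Finset.sum_congr rfl fun i _ => by ring
  rw [hnorm, hinner]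
  set N := √(∑ i ∈ G, t i ^ 2)
  set M := √(∑ i ∈ G, β i ^ 2)
  have hM : 0 ≤ M := Real.sqrt_nonneg _
  by_cases h : N > a
  · have hN : 0 < N := ha.trans_lt h
    have hcN : 1 - c = a / N := by rw [hc, blockShrinkage, if_pos h]; ring
    calc (1 - c) * (∑ i ∈ G, t i * β i - c * N ^ 2)
        ≤ a / N * (N * M - c * N ^ 2) := by rw [hcN]; gcongr
      _ = a * (M - c * N) := by field_simp
  · have hc' : c = 0 := by rw [hc, blockShrinkage, if_neg h]
    rw [hc']
    nlinarith [mul_le_mul_of_nonneg_right (not_lt.1 h) hM]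

theorem sglProx_eq_blockShrinkage_mul {p L : ℕ} (g : Fin p → Fin L) (γ lam : ℝ)
    (s : Fin p → ℝ) (j : Fin p) :
    sglProx g γ lam s j =
      blockShrinkage √(∑ i with g i = g j, softThresh (s i) (γ * lam) ^ 2)
        ((1 - γ) * lam * √(sizeOfGroup g (g j))) * softThresh (s j) (γ * lam) := by
  simp only [sglProx, blockShrinkage, groupNorm, groupSize, sizeOfGroup, Finset.sum_filter,
    ite_mul, zero_mul, mul_comm (softThresh (s j) (γ * lam))]

theorem sglProxCost_sglProx_add_le {p L : ℕ} (g : Fin p → Fin L) {γ lam : ℝ} (hγ0 : 0 ≤ γ)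
    (hγ1 : γ ≤ 1) (hlam : 0 ≤ lam) (s β : Fin p → ℝ) :
    sglProxCost g γ lam s (sglProx g γ lam s)
        + 1 / 2 * ∑ i, (β i - sglProx g γ lam s i) ^ 2
      ≤ sglProxCost g γ lam s β := by
  set η := sglProx g γ lam s
  set t : Fin p → ℝ := fun i => softThresh (s i) (γ * lam)
  set a : Fin L → ℝ := fun l => (1 - γ) * lam * √(sizeOfGroup g l)
  set c : Fin L → ℝ := fun l => blockShrinkage √(∑ i with g i = l, t i ^ 2) (a l)
  have ha (l : Fin L) : 0 ≤ a l :=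
    mul_nonneg (mul_nonneg (sub_nonneg.2 hγ1) hlam) (Real.sqrt_nonneg _)
  have hη (i : Fin p) : η i = c (g i) * t i := sglProx_eq_blockShrinkage_mul g γ lam s i
  have hl1 : ∑ i, (s i - t i) * (β i - η i) ≤ γ * lam * (∑ i, |β i| - ∑ i, |η i|) := by
    rw [← Finset.sum_sub_distrib, Finset.mul_sum]
    refine Finset.sum_le_sum fun i _ => ?_
    rw [hη]
    exact softThresh_residual_mul_le (mul_nonneg hγ0 hlam) (blockShrinkage_nonneg (ha _)) _ _
  have hgroup : ∑ i, (t i - η i) * (β i - η i)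
      ≤ ∑ l, a l * (√(∑ i with g i = l, β i ^ 2) - √(∑ i with g i = l, η i ^ 2)) := by
    rw [← Finset.sum_fiberwise Finset.univ g]
    refine Finset.sum_le_sum fun l _ => ?_
    have hηl : ∀ i ∈ Finset.univ.filter (fun i => g i = l), η i = c l * t i := by
      intro i hi
      rw [hη, (Finset.mem_filter.1 hi).2]
    have hresidual := blockShrinkage_residual_le {i | g i = l} t β (ha l) (c := c l) rfl
    rw [Finset.mul_sum] at hresidual
    rw [Finset.sum_congr rfl fun i hi => show η i ^ 2 = (c l * t i) ^ 2 by rw [hηl i hi]]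
    refine le_of_eq_of_le (Finset.sum_congr rfl fun i hi => ?_) hresidual
    rw [hηl i hi]
    ring
  have hsq : ∑ i, (s i - β i) ^ 2 = ∑ i, (s i - η i) ^ 2 + ∑ i, (β i - η i) ^ 2
      - 2 * (∑ i, (s i - t i) * (β i - η i) + ∑ i, (t i - η i) * (β i - η i)) := by
    simp only [← Finset.sum_add_distrib, Finset.mul_sum, ← Finset.sum_sub_distrib]
    exact Finset.sum_congr rfl fun i _ => by ring
  have hpenalty : ∑ l, a l * (√(∑ i with g i = l, β i ^ 2) - √(∑ i with g i = l, η i ^ 2))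
      = (1 - γ) * lam * ∑ l, √(sizeOfGroup g l) * √(∑ i with g i = l, β i ^ 2)
        - (1 - γ) * lam * ∑ l, √(sizeOfGroup g l) * √(∑ i with g i = l, η i ^ 2) := by
    simp only [Finset.mul_sum, ← Finset.sum_sub_distrib]
    exact Finset.sum_congr rfl fun l _ => by ring
  simp only [sglProxCost, ← Finset.sum_filter]
  linarith

/-- `η_γ(s, λ)` is the unique global minimizer of the SGL proximal cost. -/
theorem sglProx_isUniqueMinimizer {p L : ℕ} (hp : 1 ≤ p) (hL : 1 ≤ L)
    (g : Fin p → Fin L) (γ lam : ℝ) (hγ0 : 0 ≤ γ) (hγ1 : γ ≤ 1) (hlam : 0 ≤ lam)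
    (s : Fin p → ℝ) :
    ∀ β : Fin p → ℝ, β ≠ sglProx g γ lam s →
      sglProxCost g γ lam s (sglProx g γ lam s) < sglProxCost g γ lam s β := by
  intro β hβ
  have hle := sglProxCost_sglProx_add_le g hγ0 hγ1 hlam s β
  obtain ⟨j, hj⟩ := Function.ne_iff.1 hβ
  have hpos : 0 < ∑ i, (β i - sglProx g γ lam s i) ^ 2 :=
    Finset.sum_pos' (fun i _ => sq_nonneg _)
      ⟨j, Finset.mem_univ j, sq_pos_of_ne_zero (sub_ne_zero.2 hj)⟩
  linarith
end
end

section
/- Let f : ℝ^d → ℝ be convex and positively homogeneous of degree 1 (f(a·x) = a·f(x) for all a > 0 and x ∈ ℝ^d), let c ≥ 0, and let s ∈ ℝ^d. If u is the unique global minimizer over b ∈ ℝ^d of (1/2)‖s − b‖₂² + f(b), and v is the unique global minimizer over b ∈ ℝ^d of (1/2)‖u − b‖₂² + c‖b‖₂, then v is the unique global minimizer over b ∈ ℝ^d of (1/2)‖s − b‖₂² + f(b) + c‖b‖₂; that is, prox_{f + c‖·‖₂} = prox_{c‖·‖₂} ∘ prox_f. -/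
noncomputable section

open scoped InnerProductSpace

section Prox

variable {E : Type*} [NormedAddCommGroup E] [InnerProductSpace ℝ E]

/-- Fermat's rule for the proximal operator: if `u` minimizes `b ↦ ½‖s - b‖² + f b` with `f`
convex, then `s - u` is a subgradient of `f` at `u`. -/
theorem ConvexOn.add_inner_le_of_prox {f : E → ℝ} (hf : ConvexOn ℝ Set.univ f) {s u : E}
    (hu : ∀ b, (1 / 2) * ‖s - u‖ ^ 2 + f u ≤ (1 / 2) * ‖s - b‖ ^ 2 + f b) (b : E) :
    f u + ⟪s - u, b - u⟫_ℝ ≤ f b := by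
  by_contra! h
  obtain ⟨K, hK⟩ : ∃ K, K = f u + ⟪s - u, b - u⟫_ℝ - f b := ⟨_, rfl⟩
  have hK0 : 0 < K := by linarith
  have hN : 0 ≤ ‖b - u‖ ^ 2 := by positivity
  obtain ⟨t, ht⟩ : ∃ t, t = K / (‖b - u‖ ^ 2 + K) := ⟨_, rfl⟩
  have ht0 : 0 < t := by rw [ht]; positivity
  have htK : t * (‖b - u‖ ^ 2 + K) = K := by rw [ht]; field_simp
  have ht1 : t ≤ 1 := by rw [ht, div_le_one (by positivity)]; linarith
  have hmin := hu ((1 - t) • u + t • b)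
  have hcv := hf.2 (Set.mem_univ u) (Set.mem_univ b) (sub_nonneg.2 ht1) ht0.le (by ring)
  have hexp : s - ((1 - t) • u + t • b) = (s - u) - t • (b - u) := by module
  rw [hexp, norm_sub_sq_real (s - u), norm_smul, inner_smul_right, mul_pow,
    Real.norm_eq_abs, sq_abs] at hmin
  simp only [smul_eq_mul] at hcv
  have hscaled : t * K ≤ t * (t * ‖b - u‖ ^ 2 / 2) := by rw [hK]; linarith
  have hle := le_of_mul_le_mul_left hscaled ht0
  nlinarith [mul_pos ht0 hK0]

/-- A subgradient `g` at `u` of a positively homogeneous function satisfies `f u = ⟪g, u⟫`. -/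
theorem eq_inner_of_subgradient_of_posHom {f : E → ℝ}
    (hhom : ∀ a : ℝ, 0 < a → ∀ x, f (a • x) = a * f x) {g u : E}
    (hg : ∀ b, f u + ⟪g, b - u⟫_ℝ ≤ f b) : f u = ⟪g, u⟫_ℝ := by
  have h₂ := hg ((2 : ℝ) • u)
  have h₁ := hg ((1 / 2 : ℝ) • u)
  rw [hhom _ (by norm_num), inner_sub_right, inner_smul_right] at h₁ h₂
  linarith

/-- The proximal point of `c‖·‖` at `u` is a nonnegative multiple of `u`. -/
theorem exists_nonneg_smul_eq_of_prox_norm {c : ℝ} (hc : 0 ≤ c) {u v : E}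
    (hv : ∀ b, b ≠ v → (1 / 2) * ‖u - v‖ ^ 2 + c * ‖v‖ < (1 / 2) * ‖u - b‖ ^ 2 + c * ‖b‖) :
    ∃ t : ℝ, 0 ≤ t ∧ v = t • u := by
  rcases eq_or_ne u 0 with rfl | hu
  · refine ⟨0, le_rfl, ?_⟩
    by_contra hne
    have h := hv 0 (by simpa [eq_comm] using hne)
    simp only [sub_zero, norm_zero] at h
    nlinarith [mul_nonneg hc (norm_nonneg v), sq_nonneg ‖(0 : E) - v‖]
  · have hu' : 0 < ‖u‖ := norm_pos_iff.2 hu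
    refine ⟨‖v‖ / ‖u‖, by positivity, ?_⟩
    by_contra hne
    have h := hv _ (Ne.symm hne)
    have hnorm : ‖(‖v‖ / ‖u‖) • u‖ = ‖v‖ := by
      rw [norm_smul, Real.norm_of_nonneg (by positivity), div_mul_cancel₀ _ hu'.ne']
    have hinner : ⟪u, (‖v‖ / ‖u‖) • u⟫_ℝ = ‖u‖ * ‖v‖ := by
      rw [inner_smul_right, real_inner_self_eq_norm_sq]
      field_simp
    rw [norm_sub_sq_real, norm_sub_sq_real, hnorm, hinner] at h
    linarith [real_inner_le_norm u v]

end Prox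

/-- for `f` convex and positively homogeneous of degree 1 and `c ≥ 0`,
`prox_{f + c‖·‖₂} = prox_{c‖·‖₂} ∘ prox_f`, stated via unique global minimizers. -/
theorem prox_comp {d : ℕ} (f : EuclideanSpace ℝ (Fin d) → ℝ)
    (hconv : ConvexOn ℝ Set.univ f)
    (hhom : ∀ (a : ℝ), 0 < a → ∀ x : EuclideanSpace ℝ (Fin d), f (a • x) = a * f x)
    (c : ℝ) (hc : 0 ≤ c) (s u v : EuclideanSpace ℝ (Fin d))
    (hu : ∀ b : EuclideanSpace ℝ (Fin d), b ≠ u →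
      (1 / 2) * ‖s - u‖ ^ 2 + f u < (1 / 2) * ‖s - b‖ ^ 2 + f b)
    (hv : ∀ b : EuclideanSpace ℝ (Fin d), b ≠ v →
      (1 / 2) * ‖u - v‖ ^ 2 + c * ‖v‖ < (1 / 2) * ‖u - b‖ ^ 2 + c * ‖b‖) :
    ∀ b : EuclideanSpace ℝ (Fin d), b ≠ v →
      (1 / 2) * ‖s - v‖ ^ 2 + f v + c * ‖v‖ < (1 / 2) * ‖s - b‖ ^ 2 + f b + c * ‖b‖ := by
  have hsub := hconv.add_inner_le_of_prox (s := s) (u := u) fun b => by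
    rcases eq_or_ne b u with rfl | hb
    · exact le_rfl
    · exact (hu b hb).le
  have hfu := eq_inner_of_subgradient_of_posHom hhom hsub
  have hfv : f v = ⟪s - u, v⟫_ℝ := by
    obtain ⟨t, ht, rfl⟩ := exists_nonneg_smul_eq_of_prox_norm hc hv
    rcases ht.eq_or_lt with rfl | ht
    · have h0 := hhom 2 two_pos 0
      rw [smul_zero] at h0
      rw [zero_smul, inner_zero_right]
      linarith
    · rw [hhom t ht, hfu, inner_smul_right]
  intro b hb
  have hfb := hsub b
  have hlt := hv b hb
  rw [hfu, inner_sub_right] at hfb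
  rw [hfv]
  simp only [norm_sub_sq_real, inner_sub_left] at *
  linarith
end
end

section
/- Let X ∈ ℝ^{n×p}, y ∈ ℝ^n, γ ∈ [0,1], θ* > 0, and set δ = n/p. Suppose β̂ ∈ ℝ^p and ẑ ∈ ℝ^n satisfy the fixed-point equations β̂ = η_γ(X^⊤ẑ + β̂, θ*) and ẑ = y − Xβ̂ + (1/δ)·ẑ·⟨η'_γ(X^⊤ẑ + β̂, θ*)⟩, where ⟨v⟩ = (1/p)Σ_{i=1}^p v_i denotes the average of the entries of a vector v ∈ ℝ^p. Set λ = θ*·(1 − (1/δ)⟨η'_γ(X^⊤ẑ + β̂, θ*)⟩) and assume λ ≥ 0. Then β̂ is a global minimizer over β ∈ ℝ^p of the SGL cost (1/2)‖y − Xβ‖₂² + (1−γ)λ Σ_{l=1}^L √(p_l)‖β_l‖₂ + γλ‖β‖₁. -/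
noncomputable section

/-- Componentwise derivative `η'_γ(s, λ)` of the SGL proximal operator. -/
def sglProxDeriv {p L : ℕ} (g : Fin p → Fin L) (γ lam : ℝ) (s : Fin p → ℝ) (j : Fin p) : ℝ :=
  if groupNorm g (fun i => softThresh (s i) (γ * lam)) j
      > (1 - γ) * lam * Real.sqrt (groupSize g j) then
    (if |s j| > γ * lam then (1 : ℝ) else 0) *
      (1 - ((1 - γ) * lam * Real.sqrt (groupSize g j) /
            groupNorm g (fun i => softThresh (s i) (γ * lam)) j) *
        (1 - (softThresh (s j) (γ * lam)) ^ 2 /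
            (groupNorm g (fun i => softThresh (s i) (γ * lam)) j) ^ 2))
  else 0

/-- SGL cost `½‖y − Xβ‖₂² + (1−γ)λ Σ_l √(p_l)‖β_l‖₂ + γλ‖β‖₁`. -/
def sglCost {n p L : ℕ} (g : Fin p → Fin L) (γ lam : ℝ)
    (X : Matrix (Fin n) (Fin p) ℝ) (y : Fin n → ℝ) (β : Fin p → ℝ) : ℝ :=
  (1 / 2) * ∑ a : Fin n, (y a - X.mulVec β a) ^ 2
    + (1 - γ) * lam * ∑ l : Fin L, Real.sqrt (sizeOfGroup g l) *
        Real.sqrt (∑ i : Fin p, if g i = l then (β i) ^ 2 else 0)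
    + γ * lam * ∑ i : Fin p, |β i|

theorem abs_sub_softThresh_le {t : ℝ} (ht : 0 ≤ t) (x : ℝ) : |x - softThresh x t| ≤ t := by
  unfold softThresh
  split_ifs <;> rw [abs_le] <;> constructor <;> linarith

theorem sub_softThresh_mul_softThresh (t x : ℝ) :
    (x - softThresh x t) * softThresh x t = t * |softThresh x t| := by
  unfold softThresh
  split_ifs with h1 h2
  · rw [abs_of_pos (by linarith)]; ring
  · rw [abs_of_neg (by linarith)]; ring
  · simp

/-- Subgradient inequality for `k‖·‖₂ + t‖·‖₁` at the block soft-thresholding of `w`, where `v` is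
a subgradient of `t‖·‖₁` at `w`. -/
theorem sum_residual_mul_sub_le {ι : Type*} (S : Finset ι) (w v b β : ι → ℝ) {t k : ℝ}
    (hk : 0 ≤ k) (hv : ∀ i, |v i| ≤ t) (hvw : ∀ i, v i * w i = t * |w i|)
    (hb : ∀ i ∈ S, b i = if √(∑ i ∈ S, w i ^ 2) > k
      then w i * (1 - k / √(∑ i ∈ S, w i ^ 2)) else 0) :
    ∑ i ∈ S, (v i + w i - b i) * (β i - b i) ≤
      k * (√(∑ i ∈ S, β i ^ 2) - √(∑ i ∈ S, b i ^ 2)) +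
        t * (∑ i ∈ S, |β i| - ∑ i ∈ S, |b i|) := by
  have hvβ : ∑ i ∈ S, v i * β i ≤ t * ∑ i ∈ S, |β i| := by
    rw [Finset.mul_sum]
    refine Finset.sum_le_sum fun i _ => ?_
    calc v i * β i ≤ |v i * β i| := le_abs_self _
      _ = |v i| * |β i| := abs_mul _ _
      _ ≤ t * |β i| := by gcongr; exact hv i
  have hwβ := Real.sum_mul_le_sqrt_mul_sqrt S w β
  have hN2 : √(∑ i ∈ S, w i ^ 2) ^ 2 = ∑ i ∈ S, w i ^ 2 :=
    Real.sq_sqrt (Finset.sum_nonneg fun i _ => sq_nonneg _)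
  set N := √(∑ i ∈ S, w i ^ 2)
  by_cases h : N > k
  · have hNpos : 0 < N := hk.trans_lt h
    have hb' : ∀ i ∈ S, b i = w i * (1 - k / N) := fun i hi => by rw [hb i hi, if_pos h]
    have hc : 0 ≤ 1 - k / N := by
      rw [sub_nonneg, div_le_one hNpos]; exact h.le
    have hb2 : √(∑ i ∈ S, b i ^ 2) = N - k := by
      have : ∑ i ∈ S, b i ^ 2 = (N - k) ^ 2 := by
        calc ∑ i ∈ S, b i ^ 2 = ∑ i ∈ S, w i ^ 2 * (1 - k / N) ^ 2 :=
              Finset.sum_congr rfl fun i hi => by rw [hb' i hi]; ring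
          _ = (N - k) ^ 2 := by
              rw [← Finset.sum_mul, ← hN2]; field_simp
      rw [this, Real.sqrt_sq (by linarith)]
    have hexp : ∑ i ∈ S, (v i + w i - b i) * (β i - b i) =
        ∑ i ∈ S, v i * β i - t * ∑ i ∈ S, |b i| + k / N * ∑ i ∈ S, w i * β i
          - k / N * (1 - k / N) * ∑ i ∈ S, w i ^ 2 := by
      simp only [Finset.mul_sum, ← Finset.sum_sub_distrib, ← Finset.sum_add_distrib]
      refine Finset.sum_congr rfl fun i hi => ?_
      rw [hb' i hi, abs_mul, abs_of_nonneg hc]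
      linear_combination (-(1 - k / N)) * hvw i
    have hlast : k / N * (1 - k / N) * ∑ i ∈ S, w i ^ 2 = k * (N - k) := by
      rw [← hN2]; field_simp
    have hmid : k / N * ∑ i ∈ S, w i * β i ≤ k * √(∑ i ∈ S, β i ^ 2) := by
      calc k / N * ∑ i ∈ S, w i * β i ≤ k / N * (N * √(∑ i ∈ S, β i ^ 2)) := by gcongr
        _ = k * √(∑ i ∈ S, β i ^ 2) := by field_simp
    rw [hexp, hlast, hb2]
    linarith
  · have hb' : ∀ i ∈ S, b i = 0 := fun i hi => by rw [hb i hi, if_neg h]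
    have hb1 : ∑ i ∈ S, |b i| = 0 := Finset.sum_eq_zero fun i hi => by simp [hb' i hi]
    have hb2 : ∑ i ∈ S, b i ^ 2 = 0 := Finset.sum_eq_zero fun i hi => by simp [hb' i hi]
    have hexp : ∑ i ∈ S, (v i + w i - b i) * (β i - b i) =
        ∑ i ∈ S, v i * β i + ∑ i ∈ S, w i * β i := by
      rw [← Finset.sum_add_distrib]
      exact Finset.sum_congr rfl fun i hi => by rw [hb' i hi]; ring
    have hmid : N * √(∑ i ∈ S, β i ^ 2) ≤ k * √(∑ i ∈ S, β i ^ 2) := by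
      gcongr; exact not_lt.mp h
    rw [hexp, hb1, hb2, Real.sqrt_zero]
    linarith

/-- The residual `s - η_γ(s, θ)` is a subgradient of the SGL penalty at `η_γ(s, θ)`. -/
theorem sum_sub_sglProx_mul_le {p L : ℕ} (g : Fin p → Fin L) {γ θ : ℝ} (hγ0 : 0 ≤ γ)
    (hγ1 : γ ≤ 1) (hθ : 0 ≤ θ) (s b β : Fin p → ℝ) (hb : ∀ j, b j = sglProx g γ θ s j) :
    ∑ i, (s i - b i) * (β i - b i) ≤
      (1 - γ) * θ * (∑ l : Fin L, √(sizeOfGroup g l) * √(∑ i, if g i = l then β i ^ 2 else 0)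
        - ∑ l : Fin L, √(sizeOfGroup g l) * √(∑ i, if g i = l then b i ^ 2 else 0))
      + γ * θ * (∑ i, |β i| - ∑ i, |b i|) := by
  have ht : 0 ≤ γ * θ := mul_nonneg hγ0 hθ
  have key (l : Fin L) := sum_residual_mul_sub_le (Finset.univ.filter fun i => g i = l)
    (fun i => softThresh (s i) (γ * θ)) (fun i => s i - softThresh (s i) (γ * θ)) b β
    (k := (1 - γ) * θ * √(sizeOfGroup g l))
    (mul_nonneg (mul_nonneg (sub_nonneg.2 hγ1) hθ) (Real.sqrt_nonneg _))
    (fun i => abs_sub_softThresh_le ht (s i))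
    (fun i => sub_softThresh_mul_softThresh (γ * θ) (s i))
    (by
      intro i hi
      obtain rfl : g i = l := (Finset.mem_filter.1 hi).2
      rw [hb i, Finset.sum_filter]
      rfl)
  have hsum := Finset.sum_le_sum fun l (_ : l ∈ Finset.univ) => key l
  simp only [sub_add_cancel] at hsum
  rw [Finset.sum_fiberwise, Finset.sum_add_distrib, ← Finset.mul_sum, Finset.sum_sub_distrib,
    Finset.sum_fiberwise, Finset.sum_fiberwise] at hsum
  refine hsum.trans_eq ?_
  congr 1
  rw [← Finset.sum_sub_distrib, Finset.mul_sum]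
  refine Finset.sum_congr rfl fun l _ => ?_
  simp only [Finset.sum_filter]
  ring

/-- a fixed point of the SGL AMP iteration with threshold `θ*` is a
global minimizer of the SGL cost with penalty
`λ = θ*(1 − (1/δ)⟨η'_γ(X^⊤ẑ + β̂, θ*)⟩)`, where `δ = n/p`. -/
theorem amp_fixedPoint_minimizes {n p L : ℕ} (hn : 1 ≤ n) (hp : 1 ≤ p) (hL : 1 ≤ L)
    (g : Fin p → Fin L) (γ : ℝ) (hγ0 : 0 ≤ γ) (hγ1 : γ ≤ 1)
    (θ : ℝ) (hθ : 0 < θ)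
    (X : Matrix (Fin n) (Fin p) ℝ) (y : Fin n → ℝ)
    (βh : Fin p → ℝ) (zh : Fin n → ℝ)
    (δ : ℝ) (hδ : δ = (n : ℝ) / p)
    (hfix₁ : βh = fun j => sglProx g γ θ (fun i => X.transpose.mulVec zh i + βh i) j)
    (hfix₂ : zh = fun a => y a - X.mulVec βh a
      + (1 / δ) * zh a *
        ((∑ j : Fin p, sglProxDeriv g γ θ (fun i => X.transpose.mulVec zh i + βh i) j) / p))
    (lam : ℝ)
    (hlam : lam = θ * (1 - (1 / δ) *
      ((∑ j : Fin p, sglProxDeriv g γ θ (fun i => X.transpose.mulVec zh i + βh i) j) / p)))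
    (hlam0 : 0 ≤ lam) :
    ∀ β : Fin p → ℝ, sglCost g γ lam X y βh ≤ sglCost g γ lam X y β := by
  intro β
  set c : ℝ := 1 - (1 / δ) *
    ((∑ j : Fin p, sglProxDeriv g γ θ (fun i => X.transpose.mulVec zh i + βh i) j) / p) with hc
  have hc0 : 0 ≤ c := nonneg_of_mul_nonneg_right (hlam ▸ hlam0) hθ
  have hres (a : Fin n) : y a - X.mulVec βh a = c * zh a := by
    have := congrFun hfix₂ a
    rw [hc]
    linear_combination -this
  have hsub := sum_sub_sglProx_mul_le g hγ0 hγ1 hθ.le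
    (fun i => X.transpose.mulVec zh i + βh i) βh β (congrFun hfix₁)
  simp only [add_sub_cancel_right] at hsub
  have hadj : ∑ i, X.transpose.mulVec zh i * (β i - βh i) =
      ∑ a, zh a * (X.mulVec β a - X.mulVec βh a) := by
    change dotProduct (X.transpose.mulVec zh) (β - βh) =
      dotProduct zh (X.mulVec β - X.mulVec βh)
    rw [← Matrix.mulVec_sub, Matrix.dotProduct_mulVec, Matrix.mulVec_transpose]
  have hquad : ∑ a, (y a - X.mulVec βh a) ^ 2
      - 2 * (c * ∑ a, zh a * (X.mulVec β a - X.mulVec βh a)) ≤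
      ∑ a, (y a - X.mulVec β a) ^ 2 := by
    simp only [Finset.mul_sum, ← Finset.sum_sub_distrib]
    refine Finset.sum_le_sum fun a _ => ?_
    have hsq := sq_nonneg (X.mulVec β a - X.mulVec βh a)
    have hr := hres a
    linear_combination hsq + 2 * (X.mulVec β a - X.mulVec βh a) * hr
  rw [hadj] at hsub
  have hscaled := mul_le_mul_of_nonneg_left hsub hc0
  unfold sglCost
  rw [hlam]
  linear_combination hscaled + hquad / 2
end
end

section
/- The function T(z) = (1 + z²)Φ(−z) − zφ(z) is differentiable on ℝ with T'(z) = 2zΦ(−z) − 2φ(z); moreover T'(z) < 0 for every z ∈ ℝ, T(z) → 0 as z → +∞, and consequently T(z) > 0 for every z ∈ ℝ. -/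
noncomputable section

/-- Standard normal density `φ(z) = exp(−z²/2)/√(2π)`. -/
def gpdf (z : ℝ) : ℝ := Real.exp (-z ^ 2 / 2) / Real.sqrt (2 * Real.pi)

/-- Standard normal cumulative distribution function `Φ(z) = ∫_{−∞}^z φ(x) dx`. -/
def gcdf (z : ℝ) : ℝ := ∫ x in Set.Iic z, gpdf x

/-- `T(z) = (1 + z²)Φ(−z) − zφ(z)`. -/
def Tfun (z : ℝ) : ℝ := (1 + z ^ 2) * gcdf (-z) - z * gpdf z

lemma gpdf_pos (z : ℝ) : 0 < gpdf z := by
  unfold gpdf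
  positivity

lemma gpdf_neg (z : ℝ) : gpdf (-z) = gpdf z := by
  simp [gpdf]

lemma gpdf_eq (z : ℝ) :
    gpdf z = Real.exp (-(1 / 2) * z ^ 2) / Real.sqrt (2 * Real.pi) := by
  unfold gpdf
  ring_nf

lemma gpdf_le_exp (z : ℝ) : gpdf z ≤ Real.exp (-z ^ 2 / 2) := by
  refine div_le_self (Real.exp_pos _).le (Real.one_le_sqrt.2 ?_)
  linarith [Real.pi_gt_three]

lemma hasDerivAt_gpdf (z : ℝ) : HasDerivAt gpdf (-z * gpdf z) z := by
  have h : HasDerivAt (fun x : ℝ => -x ^ 2 / 2) (-z) z := by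
    convert! ((hasDerivAt_pow 2 z).neg.div_const 2) using 1
    simp
    ring
  convert! h.exp.div_const (Real.sqrt (2 * Real.pi)) using 1
  unfold gpdf
  ring

lemma continuous_gpdf : Continuous gpdf :=
  continuous_iff_continuousAt.2 fun z => (hasDerivAt_gpdf z).continuousAt

lemma integrable_gpdf : MeasureTheory.Integrable gpdf := by
  simpa only [← gpdf_eq] using
    (integrable_exp_neg_mul_sq (b := 1 / 2) (by norm_num)).div_const (Real.sqrt (2 * Real.pi))

lemma integrable_mul_gpdf : MeasureTheory.Integrable fun x => x * gpdf x := by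
  simpa only [mul_div_assoc, ← gpdf_eq] using
    (integrable_mul_exp_neg_mul_sq (b := 1 / 2) (by norm_num)).div_const
      (Real.sqrt (2 * Real.pi))

lemma gpdf_le_two_div_sq {z : ℝ} (hz : z ≠ 0) : gpdf z ≤ 2 / z ^ 2 := by
  have hz2 : 0 < z ^ 2 := by positivity
  refine (gpdf_le_exp z).trans ?_
  rw [neg_div, Real.exp_neg, ← inv_div (z ^ 2) 2]
  exact inv_anti₀ (by positivity) (by linarith [Real.add_one_le_exp (z ^ 2 / 2)])

lemma gpdf_le_one (z : ℝ) : gpdf z ≤ 1 :=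
  (gpdf_le_exp z).trans (Real.exp_le_one_iff.2 (by nlinarith [sq_nonneg z]))

lemma tendsto_gpdf_atBot : Filter.Tendsto gpdf Filter.atBot (nhds 0) := by
  have h : Filter.Tendsto (fun z : ℝ => 2 * (z⁻¹) ^ 2) Filter.atBot (nhds 0) := by
    simpa using (tendsto_inv_atBot_zero (𝕜 := ℝ)).pow 2 |>.const_mul 2
  refine squeeze_zero' (.of_forall fun z => (gpdf_pos z).le) ?_ h
  filter_upwards [Filter.eventually_lt_atBot 0] with z hz
  simpa [div_eq_mul_inv] using gpdf_le_two_div_sq hz.ne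

lemma hasDerivAt_gcdf (z : ℝ) : HasDerivAt gcdf (gpdf z) z := by
  have h : gcdf = fun x => gcdf 0 + ∫ t in (0 : ℝ)..x, gpdf t := by
    funext x
    rw [← intervalIntegral.integral_Iic_sub_Iic integrable_gpdf.integrableOn
      integrable_gpdf.integrableOn]
    simp [gcdf]
  rw [h]
  exact (continuous_gpdf.integral_hasStrictDerivAt 0 z).hasDerivAt.const_add _

lemma gcdf_nonneg (z : ℝ) : 0 ≤ gcdf z :=
  MeasureTheory.integral_nonneg fun x => (gpdf_pos x).le

lemma integral_Iic_mul_gpdf (z : ℝ) : ∫ x in Set.Iic z, x * gpdf x = -gpdf z := by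
  have h := MeasureTheory.integral_Iic_of_hasDerivAt_of_tendsto' (a := z)
    (fun x _ => hasDerivAt_gpdf x)
    (by simp only [neg_mul]; exact integrable_mul_gpdf.neg.integrableOn) tendsto_gpdf_atBot
  simp only [neg_mul, MeasureTheory.integral_neg, sub_zero] at h
  linarith

lemma integral_Iic_sub_mul_gpdf (z : ℝ) :
    ∫ x in Set.Iic z, (z - x) * gpdf x = z * gcdf z + gpdf z := by
  simp only [sub_mul]
  rw [MeasureTheory.integral_sub (integrable_gpdf.const_mul z).integrableOn
    integrable_mul_gpdf.integrableOn, MeasureTheory.integral_const_mul, integral_Iic_mul_gpdf]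
  simp [gcdf]

lemma mul_gcdf_add_gpdf_pos (z : ℝ) : 0 < z * gcdf z + gpdf z := by
  rw [← integral_Iic_sub_mul_gpdf, MeasureTheory.integral_Iic_eq_integral_Iio,
    MeasureTheory.setIntegral_pos_iff_support_of_nonneg_ae]
  · have h : Set.Iio z ⊆ Function.support fun x => (z - x) * gpdf x := fun x hx =>
      (mul_pos (sub_pos.2 hx) (gpdf_pos x)).ne'
    rw [Set.inter_eq_right.2 h]
    simp
  · filter_upwards [MeasureTheory.ae_restrict_mem measurableSet_Iio] with x hx
    exact (mul_pos (sub_pos.2 hx) (gpdf_pos x)).le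
  · simp only [sub_mul]
    exact ((integrable_gpdf.const_mul z).sub integrable_mul_gpdf).integrableOn

/-- The Mills ratio bound `zΦ(−z) < φ(z)`. -/
lemma mul_gcdf_neg_lt_gpdf (z : ℝ) : z * gcdf (-z) < gpdf z := by
  have h := mul_gcdf_add_gpdf_pos (-z)
  rw [gpdf_neg] at h
  linarith

lemma hasDerivAt_Tfun (z : ℝ) :
    HasDerivAt Tfun (2 * z * gcdf (-z) - 2 * gpdf z) z := by
  have hQ : HasDerivAt (fun x => gcdf (-x)) (-gpdf z) z := by
    simpa [gpdf_neg, Function.comp_def] using (hasDerivAt_gcdf (-z)).comp z (hasDerivAt_neg z)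
  convert! (((hasDerivAt_pow 2 z).const_add 1).mul hQ).sub
    ((hasDerivAt_id z).mul (hasDerivAt_gpdf z)) using 1
  simp
  ring

lemma abs_Tfun_le {z : ℝ} (hz : 0 < z) : |Tfun z| ≤ 2 / z := by
  have hφ : z * gpdf z ≤ 2 / z :=
    (mul_le_mul_of_nonneg_left (gpdf_le_two_div_sq hz.ne') hz.le).trans_eq (by field_simp)
  have hQ : gcdf (-z) ≤ 1 / z := by
    rw [le_div_iff₀ hz]
    linarith [mul_gcdf_neg_lt_gpdf z, gpdf_le_one z]
  have hM := mul_le_mul_of_nonneg_left (mul_gcdf_neg_lt_gpdf z).le hz.le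
  have h12 : 1 / z ≤ 2 / z := by gcongr; norm_num
  have h0 := mul_nonneg (add_nonneg zero_le_one (sq_nonneg z)) (gcdf_nonneg (-z))
  unfold Tfun
  rw [abs_le]
  constructor <;> linarith

lemma tendsto_Tfun_atTop : Filter.Tendsto Tfun Filter.atTop (nhds 0) := by
  refine squeeze_zero_norm' ?_ (Filter.tendsto_id.const_div_atTop (2 : ℝ))
  filter_upwards [Filter.eventually_gt_atTop 0] with z hz
  exact abs_Tfun_le hz

/-- `T` is differentiable with `T'(z) = 2zΦ(−z) − 2φ(z) < 0`,
`T(z) → 0` as `z → +∞`, and `T(z) > 0` for every `z`. -/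
theorem Tfun_properties :
    (∀ z : ℝ, HasDerivAt Tfun (2 * z * gcdf (-z) - 2 * gpdf z) z) ∧
      (∀ z : ℝ, 2 * z * gcdf (-z) - 2 * gpdf z < 0) ∧
      Filter.Tendsto Tfun Filter.atTop (nhds 0) ∧
      (∀ z : ℝ, 0 < Tfun z) := by
  have hderiv : ∀ z : ℝ, HasDerivAt Tfun (2 * z * gcdf (-z) - 2 * gpdf z) z := hasDerivAt_Tfun
  have hneg : ∀ z : ℝ, 2 * z * gcdf (-z) - 2 * gpdf z < 0 := fun z => by
    linarith [mul_gcdf_neg_lt_gpdf z]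
  have hanti : StrictAnti Tfun := strictAnti_of_hasDerivAt_neg hderiv hneg
  exact ⟨hderiv, hneg, tendsto_Tfun_atTop, fun z =>
    (hanti.antitone.le_of_tendsto tendsto_Tfun_atTop (z + 1)).trans_lt (hanti (lt_add_one z))⟩
end
end

section
/- Let F : [0,∞) → ℝ be continuous, nondecreasing and concave with F(0) > 0, and suppose there exists x̄ ≥ 0 with F(x̄) < x̄. Then F has a unique fixed point x* (satisfying F(x*) = x*), and x* > 0; for every initial point x₀ ∈ [0,∞), the sequence defined by x_{t+1} = F(x_t) is monotone and converges to x*; and if F is differentiable at x*, then 0 ≤ F'(x*) < 1. -/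
noncomputable section

/-- If a concave function on `[0,∞)` is positive at `0` and reaches the diagonal at `y`, then it lies
strictly above the diagonal on `[0, y)`. -/
theorem ConcaveOn.lt_apply_of_le_apply {F : ℝ → ℝ} (hconc : ConcaveOn ℝ (Set.Ici (0 : ℝ)) F)
    (hF0 : 0 < F 0) {x y : ℝ} (hx : 0 ≤ x) (hxy : x < y) (hy : y ≤ F y) : x < F x := by
  have hy0 : 0 < y := hx.trans_lt hxy
  have hs1 : x / y < 1 := (div_lt_one hy0).2 hxy
  have hs0 : 0 ≤ x / y := by positivity
  have hcomb := hconc.2 (Set.mem_Ici.2 le_rfl) (Set.mem_Ici.2 hy0.le)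
    (sub_nonneg.2 hs1.le) hs0 (by ring)
  have hxe : x / y * y = x := div_mul_cancel₀ x hy0.ne'
  simp only [smul_eq_mul, mul_zero, zero_add, hxe] at hcomb
  have h1 : 0 < (1 - x / y) * F 0 := mul_pos (sub_pos.2 hs1) hF0
  have h2 : x / y * y ≤ x / y * F y := mul_le_mul_of_nonneg_left hy hs0
  linarith

/-- The limit of the iterates of a map that is continuous on a closed invariant set is a fixed
point. -/
theorem apply_eq_of_tendsto_iterate_of_continuousOn {X : Type*} [TopologicalSpace X] [T2Space X]
    {F : X → X} {s : Set X} (hs : IsClosed s) (hcont : ContinuousOn F s) {x l : X}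
    (hmem : ∀ t : ℕ, F^[t] x ∈ s)
    (hlim : Filter.Tendsto (fun t : ℕ => F^[t] x) Filter.atTop (nhds l)) : F l = l := by
  have hl : l ∈ s := hs.mem_of_tendsto hlim (Filter.Eventually.of_forall hmem)
  have h1 : Filter.Tendsto (fun t : ℕ => F (F^[t] x)) Filter.atTop (nhds (F l)) :=
    (hcont l hl).tendsto.comp
      (tendsto_nhdsWithin_iff.2 ⟨hlim, Filter.Eventually.of_forall hmem⟩)
  have h2 := hlim.comp (Filter.tendsto_add_atTop_nat 1)
  simp only [Function.comp_def, Function.iterate_succ_apply'] at h2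
  exact tendsto_nhds_unique h1 h2

/-- analytic core of state-evolution convergence. A continuous,
nondecreasing, concave map `F` on `[0,∞)` with `F(0) > 0` which lies below the
diagonal somewhere has a unique fixed point `x* > 0`; iteration from any
`x₀ ≥ 0` is monotone and converges to `x*`; and if `F` is differentiable at
`x*`, then `0 ≤ F'(x*) < 1`. -/
theorem stateEvolution_fixedPoint (F : ℝ → ℝ)
    (hcont : ContinuousOn F (Set.Ici (0 : ℝ)))
    (hmono : MonotoneOn F (Set.Ici (0 : ℝ)))
    (hconc : ConcaveOn ℝ (Set.Ici (0 : ℝ)) F)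
    (hF0 : 0 < F 0)
    (hbar : ∃ x : ℝ, 0 ≤ x ∧ F x < x) :
    ∃ xs : ℝ, 0 < xs ∧ F xs = xs ∧
      (∀ x : ℝ, 0 ≤ x → F x = x → x = xs) ∧
      (∀ x₀ : ℝ, 0 ≤ x₀ →
        ((Monotone fun t : ℕ => F^[t] x₀) ∨ (Antitone fun t : ℕ => F^[t] x₀)) ∧
          Filter.Tendsto (fun t : ℕ => F^[t] x₀) Filter.atTop (nhds xs)) ∧
      (∀ d : ℝ, HasDerivAt F d xs → 0 ≤ d ∧ d < 1) := by
  obtain ⟨b, hb0, hb⟩ := hbar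
  obtain ⟨p, hp, hFp⟩ : ∃ p ∈ Set.Icc 0 b, F p - p = 0 := by
    have hc : ContinuousOn (fun x => F x - x) (Set.Icc 0 b) :=
      (hcont.mono Set.Icc_subset_Ici_self).sub continuousOn_id
    exact intermediate_value_Icc' hb0 hc ⟨by linarith, by linarith⟩
  replace hFp : F p = p := sub_eq_zero.1 hFp
  have hp0 : 0 < p := by
    rcases hp.1.eq_or_lt with h | h
    · rw [← h] at hFp
      linarith
    · exact h
  have huniq : ∀ x : ℝ, 0 ≤ x → F x = x → x = p := by
    intro x hx hFx
    rcases lt_trichotomy x p with h | h | h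
    · exact absurd (hconc.lt_apply_of_le_apply hF0 hx h hFp.ge) (by simp [hFx])
    · exact h
    · exact absurd (hconc.lt_apply_of_le_apply hF0 hp0.le h hFx.ge) (by simp [hFp])
  have hbelow : ∀ x : ℝ, 0 ≤ x → x ≤ p → x ≤ F x := by
    intro x hx hxp
    rcases hxp.eq_or_lt with rfl | h
    · exact hFp.ge
    · exact (hconc.lt_apply_of_le_apply hF0 hx h hFp.ge).le
  have habove : ∀ x : ℝ, p ≤ x → F x ≤ x := by
    intro x hxp
    rcases hxp.eq_or_lt with rfl | h
    · exact hFp.le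
    · by_contra! hx
      exact absurd (hconc.lt_apply_of_le_apply hF0 hp0.le h hx.le) (by simp [hFp])
  refine ⟨p, hp0, hFp, huniq, fun x₀ hx₀ => ?_, fun d hd => ⟨?_, ?_⟩⟩
  · rcases le_total x₀ p with h | h
    · have hmem : ∀ t : ℕ, F^[t] x₀ ∈ Set.Icc 0 p := by
        have hmaps : Set.MapsTo F (Set.Icc 0 p) (Set.Icc 0 p) := fun x hx =>
          ⟨hx.1.trans (hbelow x hx.1 hx.2), (hmono hx.1 hp0.le hx.2).trans hFp.le⟩
        exact fun t => hmaps.iterate t ⟨hx₀, h⟩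
      have hm : Monotone fun t : ℕ => F^[t] x₀ := monotone_nat_of_le_succ fun t => by
        rw [Function.iterate_succ_apply']
        exact hbelow _ (hmem t).1 (hmem t).2
      have hlim := tendsto_atTop_ciSup hm ⟨p, Set.forall_mem_range.2 fun t => (hmem t).2⟩
      have hfix := apply_eq_of_tendsto_iterate_of_continuousOn isClosed_Icc
        (hcont.mono Set.Icc_subset_Ici_self) hmem hlim
      have hnonneg := ge_of_tendsto' hlim fun t => (hmem t).1
      exact ⟨Or.inl hm, huniq _ hnonneg hfix ▸ hlim⟩
    · have hmem : ∀ t : ℕ, F^[t] x₀ ∈ Set.Ici p := by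
        have hmaps : Set.MapsTo F (Set.Ici p) (Set.Ici p) := fun x hx =>
          hFp.ge.trans (hmono hp0.le (hp0.le.trans hx) hx)
        exact fun t => hmaps.iterate t h
      have hm : Antitone fun t : ℕ => F^[t] x₀ := antitone_nat_of_succ_le fun t => by
        rw [Function.iterate_succ_apply']
        exact habove _ (hmem t)
      have hlim := tendsto_atTop_ciInf hm ⟨p, Set.forall_mem_range.2 hmem⟩
      have hfix := apply_eq_of_tendsto_iterate_of_continuousOn isClosed_Ici
        (hcont.mono (Set.Ici_subset_Ici.2 hp0.le)) hmem hlim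
      have hge := ge_of_tendsto' hlim hmem
      exact ⟨Or.inr hm, huniq _ (hp0.le.trans hge) hfix ▸ hlim⟩
  · rw [← hd.hasDerivWithinAt.derivWithin (uniqueDiffOn_Ici 0 p hp0.le)]
    exact hmono.derivWithin_nonneg
  · have hslope := hconc.le_slope_of_hasDerivAt (Set.mem_Ici.2 le_rfl) (Set.mem_Ici.2 hp0.le) hp0 hd
    refine hslope.trans_lt ?_
    rw [slope_def_field, hFp, div_lt_one (by linarith)]
    linarith
end
end

section
/- Fix γ ∈ [0,1], λ ≥ 0 and m > (1−γ)λ. For each p ≥ 1 let s(p) ∈ ℝ^p, regarded as a single group of size p (so L = 1 and the SGL proximal operator is η_γ(s, λ)^{(j)} = η_soft(s^{(j)}, γλ)·(1 − (1−γ)λ√p/‖η_soft(s, γλ)‖₂) when ‖η_soft(s, γλ)‖₂ > (1−γ)λ√p, and 0 otherwise). Assume ‖η_soft(s(p), γλ)‖₂²/p → m² as p → ∞. Define h : ℝ → ℝ by h(x) = η_soft(x, γλ)·(1 − (1−γ)λ/m). Then (1/p)·‖η_γ(s(p), λ) − h(s(p))‖₂² → 0 as p → ∞, where h acts coordinatewise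 on s(p). -/
noncomputable section

/-- Single-group SGL proximal operator on `ℝ^p`:
`η_γ(s,λ)^{(j)} = η_soft(s^{(j)}, γλ)(1 − (1−γ)λ√p/‖η_soft(s,γλ)‖₂)` when
`‖η_soft(s,γλ)‖₂ > (1−γ)λ√p`, and `0` otherwise. -/
def sglProxSingle (γ lam : ℝ) {p : ℕ} (s : Fin p → ℝ) (j : Fin p) : ℝ :=
  if Real.sqrt (∑ i : Fin p, (softThresh (s i) (γ * lam)) ^ 2)
      > (1 - γ) * lam * Real.sqrt p then
    softThresh (s j) (γ * lam) *
      (1 - (1 - γ) * lam * Real.sqrt p /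
        Real.sqrt (∑ i : Fin p, (softThresh (s i) (γ * lam)) ^ 2))
  else 0

/-- asymptotic separability of the single-group SGL proximal
operator. If `‖η_soft(s(p), γλ)‖₂²/p → m²` with `m > (1−γ)λ`, then with
`h(x) = η_soft(x, γλ)(1 − (1−γ)λ/m)` acting coordinatewise,
`(1/p)‖η_γ(s(p), λ) − h(s(p))‖₂² → 0`. -/
theorem sglProx_asymptotically_separable (γ lam m : ℝ)
    (hγ0 : 0 ≤ γ) (hγ1 : γ ≤ 1) (hlam : 0 ≤ lam) (hm : (1 - γ) * lam < m)
    (s : (p : ℕ) → Fin p → ℝ)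
    (hconv : Filter.Tendsto
      (fun p : ℕ => (∑ i : Fin p, (softThresh (s p i) (γ * lam)) ^ 2) / (p : ℝ))
      Filter.atTop (nhds (m ^ 2))) :
    Filter.Tendsto
      (fun p : ℕ => (∑ j : Fin p,
          (sglProxSingle γ lam (s p) j
            - softThresh (s p j) (γ * lam) * (1 - (1 - γ) * lam / m)) ^ 2) / (p : ℝ))
      Filter.atTop (nhds 0) := by
  have hc : 0 ≤ (1 - γ) * lam := mul_nonneg (by linarith) hlam
  have hm0 : 0 < m := hc.trans_lt hm
  have hsqrt := hconv.sqrt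
  rw [Real.sqrt_sq hm0.le] at hsqrt
  have hlim := hconv.mul
    (((tendsto_const_nhds (x := (1 - γ) * lam / m)).sub
      ((tendsto_const_nhds (x := (1 - γ) * lam)).div hsqrt hm0.ne')).pow 2)
  rw [sub_self, zero_pow two_ne_zero, mul_zero] at hlim
  refine hlim.congr' ?_
  filter_upwards [hsqrt.eventually_const_lt hm, Filter.eventually_gt_atTop 0] with p hp hp0
  have hpos : 0 < Real.sqrt (p : ℝ) := Real.sqrt_pos.mpr (by exact_mod_cast hp0)
  simp only [Pi.div_apply, Real.sqrt_div' _ (Nat.cast_nonneg p)] at hp ⊢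
  rw [lt_div_iff₀ hpos] at hp
  simp only [sglProxSingle, gt_iff_lt, if_pos hp, ← mul_sub, mul_pow, ← Finset.sum_mul,
    div_div_eq_mul_div]
  ring
end
end

section
/- Let s ∈ ℝ^p, γ ∈ [0,1], λ ≥ 0, and let j be an index whose group satisfies ‖η_soft(s_{l_j}, γλ)‖₂ > (1−γ)λ√(p_{l_j}). If |s^{(j)}| > γλ, then the function t ↦ η_γ(s + t·e_j, λ)^{(j)} (where e_j is the j-th standard basis vector) is differentiable at t = 0 with derivative 1 − ((1−γ)λ√(p_{l_j})/‖η_soft(s_{l_j}, γλ)‖₂)·(1 − η_soft(s^{(j)}, γλ)²/‖η_soft(s_{l_j}, γλ)‖₂²). If instead |s^{(j)}| < γλ, this derivative equals 0. -/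
noncomputable section

theorem softThresh_of_abs_lt {x b : ℝ} (h : |x| < b) : softThresh x b = 0 := by
  obtain ⟨h₁, h₂⟩ := abs_lt.mp h
  simp [softThresh, h₁.not_gt, h₂.not_gt]

theorem hasDerivAt_softThresh_of_lt_abs {x b : ℝ} (hb : 0 ≤ b) (h : b < |x|) :
    HasDerivAt (fun y => softThresh y b) 1 x := by
  rcases lt_abs.mp h with h | h
  · refine ((hasDerivAt_id x).sub_const b).congr_of_eventuallyEq ?_
    filter_upwards [lt_mem_nhds h] with y hy
    simp [softThresh, hy]
  · have hx : x < -b := by linarith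
    refine ((hasDerivAt_id x).add_const b).congr_of_eventuallyEq ?_
    filter_upwards [gt_mem_nhds hx] with y hy
    have hyb : ¬ y > b := by linarith
    simp [softThresh, hy, hyb]

theorem hasDerivAt_softThresh_of_abs_lt {x b : ℝ} (h : |x| < b) :
    HasDerivAt (fun y => softThresh y b) 0 x := by
  refine (hasDerivAt_const x (0 : ℝ)).congr_of_eventuallyEq ?_
  filter_upwards [continuous_abs.continuousAt.eventually_lt_const h] with y hy
  exact softThresh_of_abs_lt hy

theorem hasDerivAt_groupNorm {p L : ℕ} (g : Fin p → Fin L) (j : Fin p)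
    {v : ℝ → Fin p → ℝ} {t d : ℝ} (hj : HasDerivAt (fun τ => v τ j) d t)
    (hne : ∀ i, i ≠ j → ∀ τ, v τ i = v t i) (hpos : 0 < groupNorm g (v t) j) :
    HasDerivAt (fun τ => groupNorm g (v τ) j) (v t j * d / groupNorm g (v t) j) t := by
  have hsum : HasDerivAt (fun τ => ∑ i : Fin p, if g i = g j then (v τ i) ^ 2 else 0)
      (∑ i : Fin p, if i = j then 2 * v t j * d else 0) t := by
    refine HasDerivAt.fun_sum fun i _ => ?_
    by_cases hi : i = j
    · subst hi
      simpa using hj.fun_pow 2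
    · simp only [hne i hi, hi, if_false]
      exact hasDerivAt_const _ _
  rw [Finset.sum_ite_eq' Finset.univ j, if_pos (Finset.mem_univ j)] at hsum
  have hsqrt := hsum.sqrt (Real.sqrt_pos.mp hpos).ne'
  refine hsqrt.congr_deriv ?_
  rw [mul_assoc, mul_div_mul_left _ _ two_ne_zero]
  rfl

theorem sglProx_hasDerivAt_of_softThresh {p L : ℕ} (g : Fin p → Fin L) {γ lam : ℝ}
    (hγ1 : γ ≤ 1) (hlam : 0 ≤ lam) (s : Fin p → ℝ) (j : Fin p)
    (hactive : groupNorm g (fun i => softThresh (s i) (γ * lam)) j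
      > (1 - γ) * lam * Real.sqrt (groupSize g j)) {d : ℝ}
    (hd : HasDerivAt (fun y => softThresh y (γ * lam)) d (s j)) :
    HasDerivAt (fun t : ℝ => sglProx g γ lam (fun i => s i + if i = j then t else 0) j)
      (d * (1 - ((1 - γ) * lam * Real.sqrt (groupSize g j) /
            groupNorm g (fun i => softThresh (s i) (γ * lam)) j) *
        (1 - (softThresh (s j) (γ * lam)) ^ 2 /
            (groupNorm g (fun i => softThresh (s i) (γ * lam)) j) ^ 2))) 0 := by
  have hc : 0 ≤ (1 - γ) * lam * Real.sqrt (groupSize g j) :=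
    mul_nonneg (mul_nonneg (sub_nonneg.mpr hγ1) hlam) (Real.sqrt_nonneg _)
  set c := (1 - γ) * lam * Real.sqrt (groupSize g j)
  set N := groupNorm g (fun i => softThresh (s i) (γ * lam)) j
  have hN : 0 < N := hc.trans_lt hactive
  let v : ℝ → Fin p → ℝ := fun t i => softThresh (s i + if i = j then t else 0) (γ * lam)
  have hv0 : v 0 = fun i => softThresh (s i) (γ * lam) := by
    funext i
    simp [v]
  have hvj : HasDerivAt (fun t => v t j) d 0 := by
    have hd' : HasDerivAt (fun y => softThresh y (γ * lam)) d (s j + 0) := by simpa using hd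
    simpa [v] using hd'.comp_const_add (s j) 0
  have hnorm0 : groupNorm g (v 0) j = N := by rw [hv0]
  have hnorm : HasDerivAt (fun t => groupNorm g (v t) j) (v 0 j * d / groupNorm g (v 0) j) 0 :=
    hasDerivAt_groupNorm g j hvj (fun i hi t => by simp [v, hi]) (by rwa [hnorm0])
  have hformula : HasDerivAt (fun t => v t j * (1 - c / groupNorm g (v t) j)) _ 0 :=
    hvj.fun_mul <| ((hasDerivAt_const (0 : ℝ) c).fun_div hnorm
      (by rw [hnorm0]; exact hN.ne')).const_sub 1
  refine (hformula.congr_of_eventuallyEq ?_).congr_deriv ?_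
  · filter_upwards [hnorm.continuousAt.eventually_const_lt (hnorm0.symm ▸ hactive)] with t ht
    exact if_pos ht
  · rw [hnorm0, hv0]
    field_simp
    ring

/-- derivative of the `j`-th component of the SGL proximal operator
along the `j`-th coordinate direction, on the active group. -/
theorem sglProx_hasDerivAt {p L : ℕ} (g : Fin p → Fin L) (γ lam : ℝ)
    (hγ0 : 0 ≤ γ) (hγ1 : γ ≤ 1) (hlam : 0 ≤ lam) (s : Fin p → ℝ) (j : Fin p)
    (hactive : groupNorm g (fun i => softThresh (s i) (γ * lam)) j
      > (1 - γ) * lam * Real.sqrt (groupSize g j)) :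
    (γ * lam < |s j| →
      HasDerivAt (fun t : ℝ => sglProx g γ lam (fun i => s i + if i = j then t else 0) j)
        (1 - ((1 - γ) * lam * Real.sqrt (groupSize g j) /
              groupNorm g (fun i => softThresh (s i) (γ * lam)) j) *
          (1 - (softThresh (s j) (γ * lam)) ^ 2 /
              (groupNorm g (fun i => softThresh (s i) (γ * lam)) j) ^ 2)) 0) ∧
    (|s j| < γ * lam →
      HasDerivAt (fun t : ℝ => sglProx g γ lam (fun i => s i + if i = j then t else 0) j)
        0 0) := by
  refine ⟨fun h => ?_, fun h => ?_⟩
  · simpa only [one_mul] using sglProx_hasDerivAt_of_softThresh g hγ1 hlam s j hactive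
      (hasDerivAt_softThresh_of_lt_abs (mul_nonneg hγ0 hlam) h)
  · simpa only [zero_mul] using sglProx_hasDerivAt_of_softThresh g hγ1 hlam s j hactive
      (hasDerivAt_softThresh_of_abs_lt h)
end
end

section
/- Let r ∈ ℝ^d, θ > 0 and γ ∈ [0,1], and suppose ‖η_soft(r, γθ)‖₂ > (1−γ)θ√d. Set β = (1 − (1−γ)θ√d/‖η_soft(r, γθ)‖₂)·η_soft(r, γθ) (the single-group SGL proximal output). Then β ≠ 0, ‖η_soft(r, γθ)‖₂ = ‖β‖₂ + (1−γ)θ√d, and there exists v ∈ ℝ^d with |v_j| ≤ 1 for all j and v_j = sign(β_j) whenever β_j ≠ 0 (i.e. v is a subgradient of the ℓ₁ norm at β), such that r − β = θ·[(1−γ)√d·β/‖β‖₂ + γ·v]. -/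
noncomputable section

/-- ℓ₂ norm of a vector in `ℝ^d`. -/
def l2norm {d : ℕ} (v : Fin d → ℝ) : ℝ :=
  Real.sqrt (∑ i : Fin d, (v i) ^ 2)

/-- The residual of soft-thresholding at level `b` is `b` times a subgradient of the absolute value
at the thresholded point. -/
theorem exists_sub_softThresh_eq_mul (x : ℝ) {b : ℝ} (hb : 0 ≤ b) :
    ∃ v : ℝ, |v| ≤ 1 ∧ (softThresh x b ≠ 0 → v = Real.sign (softThresh x b)) ∧
      x - softThresh x b = b * v := by
  unfold softThresh
  split_ifs with h₁ h₂
  · exact ⟨1, by simp, fun _ => (Real.sign_of_pos (by linarith)).symm, by ring⟩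
  · exact ⟨-1, by simp, fun _ => (Real.sign_of_neg (by linarith)).symm, by ring⟩
  · have hx : |x| ≤ b := abs_le.2 ⟨not_lt.1 h₂, not_lt.1 h₁⟩
    refine ⟨x / b, ?_, fun h => absurd rfl h, ?_⟩
    · rw [abs_div, abs_of_nonneg hb]
      exact div_le_one_of_le₀ hx hb
    · rcases hb.eq_or_lt with rfl | hb
      · simpa using hx
      · field_simp
        ring

theorem l2norm_const_mul {d : ℕ} {c : ℝ} (hc : 0 ≤ c) (v : Fin d → ℝ) :
    l2norm (fun i => c * v i) = c * l2norm v := by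
  simp only [l2norm, mul_pow, ← Finset.mul_sum]
  rw [Real.sqrt_mul (sq_nonneg c), Real.sqrt_sq hc]

theorem Real.sign_mul_of_pos_left {c : ℝ} (hc : 0 < c) (x : ℝ) :
    Real.sign (c * x) = Real.sign x := by
  rcases lt_trichotomy x 0 with hx | rfl | hx
  · rw [Real.sign_of_neg hx, Real.sign_of_neg (mul_neg_of_pos_of_neg hc hx)]
  · simp
  · rw [Real.sign_of_pos hx, Real.sign_of_pos (mul_pos hc hx)]

/-- subgradient decomposition of the single-group SGL proximal
output. If `‖η_soft(r, γθ)‖₂ > (1−γ)θ√d` and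
`β = (1 − (1−γ)θ√d/‖η_soft(r, γθ)‖₂)·η_soft(r, γθ)`, then `β ≠ 0`,
`‖η_soft(r, γθ)‖₂ = ‖β‖₂ + (1−γ)θ√d`, and there is a subgradient `v` of the
ℓ₁ norm at `β` with `r − β = θ[(1−γ)√d β/‖β‖₂ + γ v]`. -/
theorem sglProx_subgradient {d : ℕ} (r : Fin d → ℝ) (θ γ : ℝ)
    (hθ : 0 < θ) (hγ0 : 0 ≤ γ) (hγ1 : γ ≤ 1)
    (hactive : l2norm (fun i => softThresh (r i) (γ * θ))
      > (1 - γ) * θ * Real.sqrt d)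
    (β : Fin d → ℝ)
    (hβ : β = fun i =>
      (1 - (1 - γ) * θ * Real.sqrt d / l2norm (fun i' => softThresh (r i') (γ * θ))) *
        softThresh (r i) (γ * θ)) :
    β ≠ 0 ∧
      l2norm (fun i => softThresh (r i) (γ * θ)) = l2norm β + (1 - γ) * θ * Real.sqrt d ∧
      ∃ v : Fin d → ℝ, (∀ j, |v j| ≤ 1) ∧ (∀ j, β j ≠ 0 → v j = Real.sign (β j)) ∧
        ∀ j, r j - β j = θ * ((1 - γ) * Real.sqrt d * β j / l2norm β + γ * v j) := by
  have hk : 0 ≤ (1 - γ) * θ * Real.sqrt d :=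
    mul_nonneg (mul_nonneg (sub_nonneg.2 hγ1) hθ.le) (Real.sqrt_nonneg _)
  set s : Fin d → ℝ := fun i => softThresh (r i) (γ * θ)
  set N := l2norm s
  set k := (1 - γ) * θ * Real.sqrt d with hk_def
  have hN0 : 0 < N := hk.trans_lt hactive
  set c := 1 - k / N with hc_def
  have hc : 0 < c := sub_pos.2 ((div_lt_one hN0).2 hactive)
  have hβs : β = fun i => c * s i := hβ
  have hβN : l2norm β = c * N := by rw [hβs, l2norm_const_mul hc.le]
  have hcN : N = c * N + k := by
    rw [hc_def]
    field_simp
    ring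
  choose v hv₁ hv_sign hv_eq using fun j =>
    exists_sub_softThresh_eq_mul (r j) (mul_nonneg hγ0 hθ.le)
  refine ⟨?_, by rw [hβN]; exact hcN, v, hv₁, fun j hj => ?_, fun j => ?_⟩
  · intro h
    have : l2norm β = 0 := by simp [h, l2norm]
    exact (mul_pos hc hN0).ne' (hβN ▸ this)
  · rw [hβs] at hj ⊢
    rw [Real.sign_mul_of_pos_left hc]
    exact hv_sign j (right_ne_zero_of_mul hj)
  · have hr : r j = s j + γ * θ * v j := by linarith [hv_eq j]
    have hgroup : θ * ((1 - γ) * Real.sqrt d * (c * s j) / (c * N)) = k / N * s j := by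
      rw [hk_def]
      field_simp
    rw [hβN, hβs, mul_add, hgroup, hr, hc_def]
    ring
end
end
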